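/- Consider the pendulum q̈ = ε sin q with ε > 0. Let t₀ < t₂, and for s ∈ (t₀, t₂) let L(s) denote the minimal action ∫_{t₀}^{s} A(q,q̇)dt + ∫_{s}^{t₂} A(q,q̇)dt over concatenations of solutions with boundary conditions q(t₀)=0, q(s)=π on [t₀,s] and q(s)=π, q(t₂)=2π on [s,t₂], where A(q,q̇)=½q̇² + ε(1-cos q). Then L is decreasing on (t₀, (t₀+t₂)/2] and increasing on [(t₀+t₂)/2, t₂). -/

import Mathlib

open Set

/-- Speed of the pendulum at energy `h`. -/
noncomputable def pendV (ε h x : ℝ) : ℝ := Real.sqrt (2 * (h + ε * (1 - Real.cos x)))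

noncomputable def pendG (ε h x : ℝ) : ℝ := ∫ y in (0:ℝ)..x, pendV ε h y

noncomputable def pendT (ε h x : ℝ) : ℝ := ∫ y in (0:ℝ)..x, (pendV ε h y)⁻¹

lemma pend_arg_pos {ε h : ℝ} (hε : 0 < ε) (hh : 0 < h) (x : ℝ) :
    0 < 2 * (h + ε * (1 - Real.cos x)) := by
  have : 0 ≤ ε * (1 - Real.cos x) := mul_nonneg hε.le (by linarith [Real.cos_le_one x])
  linarith

lemma pendV_pos {ε h : ℝ} (hε : 0 < ε) (hh : 0 < h) (x : ℝ) : 0 < pendV ε h x :=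
  Real.sqrt_pos.2 (pend_arg_pos hε hh x)

lemma pendV_sq {ε h : ℝ} (hε : 0 < ε) (hh : 0 < h) (x : ℝ) :
    pendV ε h x ^ 2 = 2 * (h + ε * (1 - Real.cos x)) :=
  Real.sq_sqrt (pend_arg_pos hε hh x).le

lemma pendV_cont (ε h : ℝ) : Continuous (pendV ε h) := by
  unfold pendV; fun_prop

lemma pendV_inv_cont {ε h : ℝ} (hε : 0 < ε) (hh : 0 < h) :
    Continuous (fun x => (pendV ε h x)⁻¹) :=
  (pendV_cont ε h).inv₀ fun x => (pendV_pos hε hh x).ne'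

lemma pendG_deriv (ε h x : ℝ) : HasDerivAt (pendG ε h) (pendV ε h x) x :=
  (pendV_cont ε h).integral_hasStrictDerivAt 0 x |>.hasDerivAt

lemma pendT_deriv {ε h : ℝ} (hε : 0 < ε) (hh : 0 < h) (x : ℝ) :
    HasDerivAt (pendT ε h) (pendV ε h x)⁻¹ x :=
  (pendV_inv_cont hε hh).integral_hasStrictDerivAt 0 x |>.hasDerivAt

lemma pend_lower {ε h a b : ℝ} (hε : 0 < ε) (hh : 0 < h) (hab : a ≤ b) (q : ℝ → ℝ)
    (hq : DifferentiableOn ℝ q (Icc a b)) (hq' : ContinuousOn (deriv q) (Icc a b)) :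
    pendG ε h (q b) - pendG ε h (q a) - h * (b - a) ≤
      ∫ t in a..b, ((1 / 2) * (deriv q t) ^ 2 + ε * (1 - Real.cos (q t))) := by
  have hqc := hq.continuousOn
  have hvc : ContinuousOn (fun t => pendV ε h (q t)) (Icc a b) :=
    (pendV_cont ε h).comp_continuousOn hqc
  have hcosc : ContinuousOn (fun t => Real.cos (q t)) (Icc a b) :=
    Real.continuous_cos.comp_continuousOn hqc
  have hGc : ContinuousOn (fun t => pendG ε h (q t)) (Icc a b) :=
    (continuous_iff_continuousAt.2 fun x => (pendG_deriv ε h x).continuousAt).comp_continuousOn hqc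
  have i1 : IntervalIntegrable (fun t => pendV ε h (q t) * deriv q t) MeasureTheory.volume a b :=
    ContinuousOn.intervalIntegrable_of_Icc hab (hvc.mul hq')
  have i2 : IntervalIntegrable (fun t => (1 / 2) * (deriv q t) ^ 2 + ε * (1 - Real.cos (q t)))
      MeasureTheory.volume a b :=
    ContinuousOn.intervalIntegrable_of_Icc hab (by fun_prop)
  have ftc := intervalIntegral.integral_eq_sub_of_hasDerivAt_of_le hab hGc (fun t htt => by
    have hd : DifferentiableAt ℝ q t :=
      (hq t (Ioo_subset_Icc_self htt)).differentiableAt (Icc_mem_nhds htt.1 htt.2)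
    exact (pendG_deriv ε h (q t)).comp t hd.hasDerivAt) i1
  have hc : ∫ t in a..b, h = h * (b - a) := by simp [mul_comm]
  rw [← ftc, ← hc, ← intervalIntegral.integral_sub i1 (by simp)]
  apply intervalIntegral.integral_mono_on hab (i1.sub (by simp)) i2
  intro t _
  have := pendV_sq hε hh (q t)
  nlinarith [sq_nonneg (pendV ε h (q t) - deriv q t)]

lemma pend_exact {ε h a b : ℝ} (hε : 0 < ε) (hh : 0 < h) (q : ℝ → ℝ)
    (hq : ∀ t, HasDerivAt q (pendV ε h (q t)) t) :
    ∫ t in a..b, ((1 / 2) * (deriv q t) ^ 2 + ε * (1 - Real.cos (q t))) =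
      pendG ε h (q b) - pendG ε h (q a) - h * (b - a) := by
  have hqc : Continuous q := continuous_iff_continuousAt.2 fun t => (hq t).continuousAt
  have hvc : Continuous (fun t => pendV ε h (q t)) := (pendV_cont ε h).comp hqc
  have ftc := intervalIntegral.integral_eq_sub_of_hasDerivAt (a := a) (b := b)
    (fun t _ => (pendG_deriv ε h (q t)).comp t (hq t))
    ((hvc.mul hvc).intervalIntegrable a b)
  have hc : ∫ t in a..b, h = h * (b - a) := by simp [mul_comm]
  simp only [Function.comp] at ftc
  have i1 : IntervalIntegrable (fun t => pendV ε h (q t) * pendV ε h (q t))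
      MeasureTheory.volume a b := (hvc.mul hvc).intervalIntegrable a b
  rw [← ftc, ← hc, ← intervalIntegral.integral_sub i1 (by simp)]
  apply intervalIntegral.integral_congr
  intro t _
  have := pendV_sq hε hh (q t)
  simp only [(hq t).deriv]
  nlinarith

lemma pendT_strictMono {ε h : ℝ} (hε : 0 < ε) (hh : 0 < h) : StrictMono (pendT ε h) :=
  strictMono_of_deriv_pos fun x => by
    rw [(pendT_deriv hε hh x).deriv]; exact inv_pos.2 (pendV_pos hε hh x)

lemma pendT_surj {ε h : ℝ} (hε : 0 < ε) (hh : 0 < h) : Function.Surjective (pendT ε h) := by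
  have hcont : Continuous (pendT ε h) :=
    continuous_iff_continuousAt.2 fun x => (pendT_deriv hε hh x).continuousAt
  set c : ℝ := (Real.sqrt (2 * (h + ε * 2)))⁻¹ with hc
  have hcpos : 0 < c := by rw [hc]; positivity
  have hm : Monotone (fun x => pendT ε h x - c * x) := by
    have hd : ∀ x, HasDerivAt (fun x => pendT ε h x - c * x) ((pendV ε h x)⁻¹ - c * 1) x :=
      fun x => (pendT_deriv hε hh x).sub ((hasDerivAt_id x).const_mul c)
    apply monotone_of_deriv_nonneg (fun x => (hd x).differentiableAt)
    intro x
    rw [(hd x).deriv, mul_one, sub_nonneg]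
    apply inv_anti₀ (pendV_pos hε hh x)
    apply Real.sqrt_le_sqrt
    nlinarith [Real.neg_one_le_cos x]
  have h0 : pendT ε h 0 = 0 := by simp [pendT]
  intro y
  have e1 := hm (show 0 ≤ |y| / c by positivity)
  have e2 := hm (show -(|y| / c) ≤ 0 by simp; positivity)
  have e3 : c * (|y| / c) = |y| := by field_simp
  simp only [h0, mul_neg, e3] at e1 e2
  have := intermediate_value_univ (-(|y| / c)) (|y| / c) hcont
  exact this ⟨by linarith [neg_abs_le y], by linarith [le_abs_self y]⟩

lemma pend_solution {ε h : ℝ} (hε : 0 < ε) (hh : 0 < h) :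
    ∃ Q : ℝ → ℝ, Q 0 = 0 ∧ Q (pendT ε h Real.pi) = Real.pi ∧
      ∀ t, HasDerivAt Q (pendV ε h (Q t)) t := by
  let e := (pendT_strictMono hε hh).orderIsoOfSurjective _ (pendT_surj hε hh)
  have he : ∀ x, e.symm (pendT ε h x) = x := fun x => e.symm_apply_apply x
  have he' : ∀ t, pendT ε h (e.symm t) = t := fun t => e.apply_symm_apply t
  refine ⟨e.symm, ?_, he _, fun t => ?_⟩
  · have := he 0
    simpa [pendT] using this
  · have := HasDerivAt.of_local_left_inverse (f := pendT ε h) (g := e.symm) (a := t)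
      e.symm.continuous.continuousAt (pendT_deriv hε hh _)
      (inv_pos.2 (pendV_pos hε hh _)).ne' (Filter.Eventually.of_forall he')
    simpa using this

lemma pendT_small {ε T : ℝ} (hε : 0 < ε) :
    ∃ δ > 0, ∀ h, 0 < h → h ≤ δ → T ≤ pendT ε h Real.pi := by
  set r := Real.sqrt ε with hr
  have hrp : 0 < r := Real.sqrt_pos.2 hε
  have hr2 : r ^ 2 = ε := Real.sq_sqrt hε.le
  have hpi := Real.pi_pos
  set b : ℝ := r * Real.pi / Real.exp (r * T) with hb
  have hbp : 0 < b := by rw [hb]; positivity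
  refine ⟨b ^ 2 / 2, by positivity, fun h hh hle => ?_⟩
  have hvle : ∀ x ∈ Icc 0 Real.pi, (b + r * x)⁻¹ ≤ (pendV ε h x)⁻¹ := by
    intro x hx
    apply inv_anti₀ (pendV_pos hε hh x)
    have hp : 0 ≤ r * x := mul_nonneg hrp.le hx.1
    apply Real.sqrt_le_iff.2 ⟨by linarith, ?_⟩
    have h1 := Real.one_sub_sq_div_two_le_cos (x := x)
    have h2 : ε * (1 - Real.cos x) ≤ ε * (x ^ 2 / 2) :=
      mul_le_mul_of_nonneg_left (by linarith) hε.le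
    have h3 : (b + r * x) ^ 2 = b ^ 2 + 2 * (b * (r * x)) + ε * x ^ 2 := by
      rw [← hr2]; ring
    rw [h3]
    nlinarith [mul_nonneg hbp.le hp]
  have hcont : ContinuousOn (fun x => (b + r * x)⁻¹) (Icc 0 Real.pi) := by
    apply ContinuousOn.inv₀ (by fun_prop)
    intro x hx
    have hp : 0 ≤ r * x := mul_nonneg hrp.le hx.1
    linarith
  have hI := intervalIntegral.integral_mono_on (μ := MeasureTheory.volume) hpi.le
    (hcont.intervalIntegrable_of_Icc hpi.le)
    ((pendV_inv_cont hε hh).intervalIntegrable 0 Real.pi) hvle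
  have hF : ∫ x in (0:ℝ)..Real.pi, (b + r * x)⁻¹ =
      Real.log (b + r * Real.pi) / r - Real.log (b + r * 0) / r := by
    apply intervalIntegral.integral_eq_sub_of_hasDerivAt
      (f := fun x => Real.log (b + r * x) / r)
    · intro x hx
      rw [uIcc_of_le hpi.le] at hx
      have hp : 0 ≤ r * x := mul_nonneg hrp.le hx.1
      have hne : b + r * x ≠ 0 := by linarith
      have h1 : HasDerivAt (fun x => b + r * x) (r * 1) x :=
        ((hasDerivAt_id x).const_mul r).const_add b
      have h2 := (h1.log hne).div_const r
      have h3 : r * 1 / (b + r * x) / r = (b + r * x)⁻¹ := by field_simp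
      rw [h3] at h2
      exact h2
    · exact hcont.intervalIntegrable_of_Icc hpi.le
  have hlog : r * T ≤ Real.log (b + r * Real.pi) - Real.log (b + r * 0) := by
    have hx : r * Real.pi = b * Real.exp (r * T) := by rw [hb]; field_simp
    have h1 : Real.log (b * Real.exp (r * T)) ≤ Real.log (b + r * Real.pi) := by
      apply Real.log_le_log (by positivity)
      rw [← hx]; linarith
    rw [Real.log_mul hbp.ne' (Real.exp_pos _).ne', Real.log_exp] at h1
    rw [mul_zero, add_zero]; linarith
  have : T ≤ Real.log (b + r * Real.pi) / r - Real.log (b + r * 0) / r := by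
    rw [← sub_div, le_div_iff₀ hrp]; linarith
  calc T ≤ _ := this
    _ = _ := hF.symm
    _ ≤ _ := hI

lemma pendT_large {ε T : ℝ} (hε : 0 < ε) (hT : 0 < T) :
    ∃ h > 0, pendT ε h Real.pi ≤ T := by
  have hpi := Real.pi_pos
  have hc : 0 < Real.pi / T := by positivity
  refine ⟨(Real.pi / T) ^ 2 / 2, by positivity, ?_⟩
  have hh : 0 < (Real.pi / T) ^ 2 / 2 := by positivity
  have hI := intervalIntegral.integral_mono_on (μ := MeasureTheory.volume) hpi.le
    ((pendV_inv_cont hε hh).intervalIntegrable 0 Real.pi)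
    (intervalIntegrable_const (c := (Real.pi / T)⁻¹)) (fun x _ => by
      apply inv_anti₀ hc
      apply Real.le_sqrt_of_sq_le
      nlinarith [mul_nonneg hε.le (sub_nonneg.2 (Real.cos_le_one x))])
  refine hI.trans (le_of_eq ?_)
  simp

lemma pendT_cont {ε : ℝ} (hε : 0 < ε) {a b : ℝ} (ha : 0 < a) :
    ContinuousOn (fun h => pendT ε h Real.pi) (Icc a b) := by
  have key : Continuous (fun h => ∫ x in (0:ℝ)..Real.pi, (pendV ε (max a h) x)⁻¹) := by
    apply intervalIntegral.continuous_parametric_intervalIntegral_of_continuous'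
    apply Continuous.inv₀
    · unfold pendV; fun_prop
    · intro p
      exact (pendV_pos hε (lt_max_of_lt_left ha) _).ne'
  apply key.continuousOn.congr
  intro h hh
  simp [pendT, max_eq_right hh.1]

lemma pendT_exists {ε T h₀ : ℝ} (hε : 0 < ε) (hh₀ : 0 < h₀) (hT : pendT ε h₀ Real.pi ≤ T) :
    ∃ h, 0 < h ∧ h ≤ h₀ ∧ pendT ε h Real.pi = T := by
  obtain ⟨δ, hδ, H⟩ := pendT_small (ε := ε) (T := T) hε
  have hm : 0 < min δ h₀ := lt_min hδ hh₀
  have := intermediate_value_Icc' (min_le_right δ h₀) (pendT_cont hε hm)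
  obtain ⟨h, hh, e⟩ := this ⟨hT, H _ hm (min_le_left _ _)⟩
  exact ⟨h, hm.trans_le hh.1, hh.2, e⟩

def pendSet (ε t₀ t₂ s : ℝ) : Set ℝ := {a : ℝ | ∃ q₁ q₂ : ℝ → ℝ,
        DifferentiableOn ℝ q₁ (Icc t₀ s) ∧ DifferentiableOn ℝ q₂ (Icc s t₂) ∧
        ContinuousOn (deriv q₁) (Icc t₀ s) ∧ ContinuousOn (deriv q₂) (Icc s t₂) ∧
        q₁ t₀ = 0 ∧ q₁ s = Real.pi ∧ q₂ s = Real.pi ∧ q₂ t₂ = 2 * Real.pi ∧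
        a = (∫ t in t₀..s, ((1 / 2) * (deriv q₁ t) ^ 2 + ε * (1 - Real.cos (q₁ t)))) +
            ∫ t in s..t₂, ((1 / 2) * (deriv q₂ t) ^ 2 + ε * (1 - Real.cos (q₂ t)))}

lemma pendSet_lower {ε t₀ t₂ s h₁ h₂ a : ℝ} (hε : 0 < ε) (h0 : t₀ < s) (h2 : s < t₂)
    (hh₁ : 0 < h₁) (hh₂ : 0 < h₂) (ha : a ∈ pendSet ε t₀ t₂ s) :
    pendG ε h₁ Real.pi - pendG ε h₁ 0 - h₁ * (s - t₀) +
      (pendG ε h₂ (2 * Real.pi) - pendG ε h₂ Real.pi - h₂ * (t₂ - s)) ≤ a := by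
  obtain ⟨q₁, q₂, d1, d2, c1, c2, e1, e2, e3, e4, rfl⟩ := ha
  have l1 := pend_lower hε hh₁ h0.le q₁ d1 c1
  have l2 := pend_lower hε hh₂ h2.le q₂ d2 c2
  rw [e1, e2] at l1
  rw [e3, e4] at l2
  exact add_le_add l1 l2

lemma pendSet_mem {ε t₀ t₂ s h₁ h₂ : ℝ} (hε : 0 < ε)
    (hh₁ : 0 < h₁) (hh₂ : 0 < h₂)
    (hT₁ : pendT ε h₁ Real.pi = s - t₀) (hT₂ : pendT ε h₂ Real.pi = t₂ - s) :
    pendG ε h₁ Real.pi - pendG ε h₁ 0 - h₁ * (s - t₀) +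
      (pendG ε h₂ (2 * Real.pi) - pendG ε h₂ Real.pi - h₂ * (t₂ - s)) ∈ pendSet ε t₀ t₂ s := by
  obtain ⟨Q₁, a1, b1, d1⟩ := pend_solution hε hh₁
  obtain ⟨Q₂, a2, b2, d2⟩ := pend_solution hε hh₂
  rw [hT₁] at b1
  rw [hT₂] at b2
  have D1 : ∀ t, HasDerivAt (fun t => Q₁ (t - t₀)) (pendV ε h₁ (Q₁ (t - t₀))) t := fun t => by
    simpa [Function.comp_def] using (d1 (t - t₀)).comp t ((hasDerivAt_id t).sub_const t₀)
  have D2 : ∀ t, HasDerivAt (fun t => 2 * Real.pi - Q₂ (t₂ - t))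
      (pendV ε h₂ (2 * Real.pi - Q₂ (t₂ - t))) t := fun t => by
    have hv : pendV ε h₂ (2 * Real.pi - Q₂ (t₂ - t)) = pendV ε h₂ (Q₂ (t₂ - t)) := by
      simp [pendV, Real.cos_two_pi_sub]
    rw [hv]
    simpa [Function.comp_def] using ((d2 (t₂ - t)).comp t ((hasDerivAt_id t).const_sub t₂)).const_sub (2 * Real.pi)
  have C : ∀ (h : ℝ) (q : ℝ → ℝ), (∀ t, HasDerivAt q (pendV ε h (q t)) t) →
      Continuous (deriv q) := by
    intro h q hq
    have : deriv q = fun t => pendV ε h (q t) := funext fun t => (hq t).deriv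
    rw [this]
    exact (pendV_cont ε h).comp (continuous_iff_continuousAt.2 fun t => (hq t).continuousAt)
  refine ⟨fun t => Q₁ (t - t₀), fun t => 2 * Real.pi - Q₂ (t₂ - t),
    fun t _ => (D1 t).differentiableAt.differentiableWithinAt,
    fun t _ => (D2 t).differentiableAt.differentiableWithinAt,
    (C _ _ D1).continuousOn, (C _ _ D2).continuousOn, by simp [a1], b1, ?_, by simp [a2], ?_⟩
  · simp only [b2]; ring
  · rw [pend_exact hε hh₁ _ D1, pend_exact hε hh₂ _ D2]
    have e : 2 * Real.pi - Real.pi = Real.pi := by ring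
    simp only [b1, b2, sub_self, a1, a2, sub_zero, e]

lemma pendSet_nonempty {ε t₀ t₂ s : ℝ} (hε : 0 < ε) (h0 : t₀ < s) (h2 : s < t₂) :
    (pendSet ε t₀ t₂ s).Nonempty := by
  obtain ⟨k1, p1, l1⟩ := pendT_large hε (sub_pos.2 h0)
  obtain ⟨k2, p2, l2⟩ := pendT_large hε (sub_pos.2 h2)
  obtain ⟨h₁, q1, -, m1⟩ := pendT_exists hε p1 l1
  obtain ⟨h₂, q2, -, m2⟩ := pendT_exists hε p2 l2
  exact ⟨_, pendSet_mem hε q1 q2 m1 m2⟩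

lemma pend_core {ε t₀ t₂ s s' h₁ h₂ : ℝ} (hε : 0 < ε) (h0 : t₀ < s) (h2 : s < t₂)
    (h0' : t₀ < s') (h2' : s' < t₂) (hh₁ : 0 < h₁) (hh₂ : 0 < h₂)
    (hT₁ : pendT ε h₁ Real.pi = s' - t₀) (hT₂ : pendT ε h₂ Real.pi = t₂ - s')
    (hs : 0 ≤ (h₁ - h₂) * (s' - s)) :
    sInf (pendSet ε t₀ t₂ s') ≤ sInf (pendSet ε t₀ t₂ s) := by
  have hb : BddBelow (pendSet ε t₀ t₂ s') :=
    ⟨_, fun a ha => pendSet_lower hε h0' h2' hh₁ hh₂ ha⟩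
  refine (csInf_le hb (pendSet_mem hε hh₁ hh₂ hT₁ hT₂)).trans
    (le_csInf (pendSet_nonempty hε h0 h2) fun a ha => ?_)
  have := pendSet_lower hε h0 h2 hh₁ hh₂ ha
  nlinarith

/-- Monotonicity of the two-piece minimal pendulum action `𝕃(s)`: decreasing before the
midpoint of `[t₀, t₂]` and increasing after. -/
theorem pendulum_action_monotone (ε t₀ t₂ : ℝ) (hε : 0 < ε) (ht : t₀ < t₂) :
    AntitoneOn
      (fun s => sInf {a : ℝ | ∃ q₁ q₂ : ℝ → ℝ,
        DifferentiableOn ℝ q₁ (Icc t₀ s) ∧ DifferentiableOn ℝ q₂ (Icc s t₂) ∧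
        ContinuousOn (deriv q₁) (Icc t₀ s) ∧ ContinuousOn (deriv q₂) (Icc s t₂) ∧
        q₁ t₀ = 0 ∧ q₁ s = Real.pi ∧ q₂ s = Real.pi ∧ q₂ t₂ = 2 * Real.pi ∧
        a = (∫ t in t₀..s, ((1 / 2) * (deriv q₁ t) ^ 2 + ε * (1 - Real.cos (q₁ t)))) +
            ∫ t in s..t₂, ((1 / 2) * (deriv q₂ t) ^ 2 + ε * (1 - Real.cos (q₂ t)))})
      (Ioc t₀ ((t₀ + t₂) / 2)) ∧
    MonotoneOn
      (fun s => sInf {a : ℝ | ∃ q₁ q₂ : ℝ → ℝ,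
        DifferentiableOn ℝ q₁ (Icc t₀ s) ∧ DifferentiableOn ℝ q₂ (Icc s t₂) ∧
        ContinuousOn (deriv q₁) (Icc t₀ s) ∧ ContinuousOn (deriv q₂) (Icc s t₂) ∧
        q₁ t₀ = 0 ∧ q₁ s = Real.pi ∧ q₂ s = Real.pi ∧ q₂ t₂ = 2 * Real.pi ∧
        a = (∫ t in t₀..s, ((1 / 2) * (deriv q₁ t) ^ 2 + ε * (1 - Real.cos (q₁ t)))) +
            ∫ t in s..t₂, ((1 / 2) * (deriv q₂ t) ^ 2 + ε * (1 - Real.cos (q₂ t)))})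
      (Ico ((t₀ + t₂) / 2) t₂) := by
  constructor
  · intro s hs s' hs' hss
    obtain ⟨k, p, l⟩ := pendT_large hε (sub_pos.2 hs'.1)
    obtain ⟨h₁, q1, -, m1⟩ := pendT_exists hε p l
    obtain ⟨h₂, q2, le, m2⟩ := pendT_exists (T := t₂ - s') hε q1 (by linarith [hs'.2])
    exact pend_core hε hs.1 (by linarith [hs.2]) hs'.1 (by linarith [hs'.2]) q1 q2 m1 m2
      (mul_nonneg (by linarith) (by linarith))
  · intro s' hs' s hs hss
    obtain ⟨k, p, l⟩ := pendT_large hε (sub_pos.2 hs'.2)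
    obtain ⟨h₂, q2, -, m2⟩ := pendT_exists hε p l
    obtain ⟨h₁, q1, le, m1⟩ := pendT_exists (T := s' - t₀) hε q2 (by linarith [hs'.1])
    exact pend_core hε (by linarith [hs.1]) hs.2 (by linarith [hs'.1]) hs'.2 q1 q2 m1 m2
      (mul_nonneg_of_nonpos_of_nonpos (by linarith) (by linarith))
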